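/- Let q be any prime power, a, b ∈ F_q with a ≠ 0 and b ≠ 0, and f(x) = a·x + b·x^q + x^(2q−1). Then ∑_{x ∈ F_{q²}} f(x)^((q−1)·q) = (b/a) · ( ∑_{0 ≤ l ≤ q/2} binom(−l, l) · (−a/b²)^l − 1 ). -/

import Mathlib

open Finset Polynomial

/-- The Fibonacci-type polynomial `∑_{i + j = n} binom(i, j) z^j`. -/
def fibSum {R : Type*} [CommRing R] (z : R) (n : ℕ) : R :=
  ∑ p ∈ antidiagonal n, (p.1.choose p.2 : R) * z ^ p.2

theorem fibSum_zero {R : Type*} [CommRing R] (z : R) : fibSum z 0 = 1 := by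
  simp [fibSum]

theorem fibSum_one {R : Type*} [CommRing R] (z : R) : fibSum z 1 = 1 := by
  simp [fibSum, Finset.Nat.antidiagonal_succ]

theorem fibSum_add_two {R : Type*} [CommRing R] (z : R) (n : ℕ) :
    fibSum z (n + 2) = fibSum z (n + 1) + z * fibSum z n := by
  simp only [fibSum]
  rw [Finset.Nat.antidiagonal_succ_succ', Finset.Nat.antidiagonal_succ']
  simp [Nat.choose_succ_succ, sum_add_distrib, mul_sum, add_mul, mul_add, pow_succ',
    mul_left_comm]
  ring

theorem fibSum_eq_sum_range {R : Type*} [CommRing R] (z : R) {n m : ℕ} (hmn : m ≤ n)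
    (h : n ≤ 2 * m + 1) :
    fibSum z n = ∑ j ∈ range (m + 1), ((n - j).choose j : R) * z ^ j := by
  rw [fibSum, ← Finset.Nat.sum_antidiagonal_swap, Finset.Nat.sum_antidiagonal_eq_sum_range_succ_mk]
  symm
  apply sum_subset
  · intro j; simp only [mem_range]; omega
  · intro j hj hj'
    simp only [mem_range] at hj hj'
    simp [Nat.choose_eq_zero_of_lt (show n - j < j by omega)]

theorem FiniteField.cast_card_choose_eq_zero (F : Type*) [Field F] [Fintype F] {i : ℕ}
    (hi : i ≠ 0) (hi' : i < Fintype.card F) : ((Fintype.card F).choose i : F) = 0 := by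
  obtain ⟨p, hp, n, hn, hc⟩ := FiniteField.card' F
  rw [hc] at hi' ⊢
  exact (CharP.cast_eq_zero_iff F p _).2 (hn.dvd_choose_pow hi hi'.ne)

theorem FiniteField.cast_choose_card_add (F : Type*) [Field F] [Fintype F] (m : ℤ) {j : ℕ}
    (hj : j < Fintype.card F) :
    ((Ring.choose ((Fintype.card F : ℤ) + m) j : ℤ) : F) = (Ring.choose m j : ℤ) := by
  rw [Ring.add_choose_eq j (Commute.all _ _), Int.cast_sum,
    Finset.sum_eq_single_of_mem (0, j) (by simp)]
  · simp
  · rintro ⟨i, k⟩ h hne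
    have h := mem_antidiagonal.1 h
    have hi : i ≠ 0 := by
      rintro rfl; apply hne; simpa using h
    rw [Ring.choose_natCast, Int.cast_mul, Int.cast_natCast,
      FiniteField.cast_card_choose_eq_zero F hi (by simp at h; omega), zero_mul]

theorem Ring.choose_neg_succ_self (m : ℕ) :
    Ring.choose (-((m + 1 : ℕ) : ℤ) - 1) (m + 1) =
      2 * Ring.choose (-((m + 1 : ℕ) : ℤ)) (m + 1) := by
  rw [show -((m + 1 : ℕ) : ℤ) - 1 = -((m + 2 : ℕ) : ℤ) by push_cast; ring,
    Ring.choose_neg, Ring.choose_neg,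
    show ((m + 2 : ℕ) : ℤ) + (m + 1 : ℕ) - 1 = ((2 * m + 1 + 1 : ℕ) : ℤ) by push_cast; ring,
    show ((m + 1 : ℕ) : ℤ) + (m + 1 : ℕ) - 1 = ((2 * m + 1 : ℕ) : ℤ) by push_cast; ring,
    Ring.choose_natCast, Ring.choose_natCast, Nat.choose_succ_succ,
    Nat.choose_symm_half]
  simp only [Units.smul_def, smul_eq_mul]
  push_cast
  ring

theorem fibSum_card {F : Type*} [Field F] [Fintype F] (z : F) :
    fibSum z (Fintype.card F) = ∑ l ∈ range (Fintype.card F / 2 + 1),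
      ((Ring.choose (-(l : ℤ)) l : ℤ) : F) * z ^ l := by
  have hq : 1 < Fintype.card F := Fintype.one_lt_card
  rw [fibSum_eq_sum_range z (m := Fintype.card F / 2) (by omega) (by omega)]
  refine sum_congr rfl fun l hl => ?_
  have hl := mem_range.1 hl
  rw [← FiniteField.cast_choose_card_add F _ (show l < Fintype.card F by omega),
    show (Fintype.card F : ℤ) + -(l : ℤ) = ((Fintype.card F - l : ℕ) : ℤ) by omega,
    Ring.choose_natCast, Int.cast_natCast]

theorem fibSum_card_sub_one {F : Type*} [Field F] [Fintype F] (z : F) :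
    fibSum z (Fintype.card F - 1) = 2 * fibSum z (Fintype.card F) - 1 := by
  have hq : 1 < Fintype.card F := Fintype.one_lt_card
  rw [fibSum_card, fibSum_eq_sum_range z (m := Fintype.card F / 2) (by omega) (by omega),
    sum_range_succ', sum_range_succ', mul_add, mul_sum]
  have : ∀ l ∈ range (Fintype.card F / 2),
      ((Fintype.card F - 1 - (l + 1)).choose (l + 1) : F) * z ^ (l + 1) =
        2 * (((Ring.choose (-((l + 1 : ℕ) : ℤ)) (l + 1) : ℤ) : F) * z ^ (l + 1)) := by
    intro l hl
    have hl := mem_range.1 hl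
    have h := congrArg (Int.cast : ℤ → F) (Ring.choose_neg_succ_self l)
    rw [← FiniteField.cast_choose_card_add F _ (show l + 1 < Fintype.card F by omega),
      show (Fintype.card F : ℤ) + (-((l + 1 : ℕ) : ℤ) - 1) =
        ((Fintype.card F - 1 - (l + 1) : ℕ) : ℤ) by omega,
      Ring.choose_natCast, Int.cast_natCast] at h
    rw [h]
    push_cast
    ring
  rw [sum_congr rfl this]
  simp
  ring

theorem FiniteField.sum_pow_of_ne_zero {K : Type*} [Field K] [Fintype K] {i : ℕ} (hi : i ≠ 0) :
    ∑ x : K, x ^ i = if Fintype.card K - 1 ∣ i then -1 else 0 := by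
  classical
  rw [← FiniteField.sum_pow_units, ← sum_erase_add _ _ (mem_univ (0 : K)), zero_pow hi, add_zero]
  symm
  refine sum_bij (fun u _ => (u : K)) (by simp) (fun _ _ _ _ h => Units.ext h) ?_ (by simp)
  intro x hx
  exact ⟨Units.mk0 x (by simpa using hx), mem_univ _, rfl⟩

theorem coeff_trinomial_pow_card_sub_one {F : Type*} [Field F] [Fintype F] {a b : F} (hb : b ≠ 0)
    {n : ℕ} (hn : n < Fintype.card F) :
    ((1 + C b * X + C a * X ^ 2 : F[X]) ^ (Fintype.card F - 1)).coeff n =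
      (-b) ^ n * fibSum (-a / b ^ 2) n := by
  set h : F[X] := 1 + C b * X + C a * X ^ 2 with hh
  set g := h ^ (Fintype.card F - 1) with hg
  have hgh : g + C b * (X * g) + C a * (X ^ 2 * g) = expand F (Fintype.card F) h := by
    rw [FiniteField.expand_card, ← pow_sub_one_mul Fintype.card_ne_zero h, ← hg, hh]
    ring
  have hcoeff : ∀ k, 0 < k → k < Fintype.card F →
      (g + C b * (X * g) + C a * (X ^ 2 * g)).coeff k = 0 := by
    intro k hk hk'
    rw [hgh, coeff_expand Fintype.card_pos,
      if_neg (fun hd => absurd (Nat.le_of_dvd hk hd) (by omega))]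
  induction n using Nat.twoStepInduction with
  | zero => simp [g, h, fibSum_zero, coeff_zero_eq_eval_zero]
  | one =>
    have h1 := hcoeff 1 one_pos hn
    have h0 : g.coeff 0 = 1 := by simp [g, h, coeff_zero_eq_eval_zero]
    simp only [coeff_add, coeff_C_mul, coeff_X_mul, coeff_X_pow_mul', h0] at h1
    norm_num at h1
    rw [fibSum_one]
    linear_combination h1
  | more n ih0 ih1 =>
    have h2 := hcoeff (n + 2) (by omega) hn
    simp only [coeff_add, coeff_C_mul, coeff_X_mul, coeff_X_pow_mul, ih0 (by omega),
      ih1 (by omega)] at h2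
    rw [fibSum_add_two]
    have : -a / b ^ 2 * b ^ 2 = -a := by field_simp
    linear_combination h2 - (-b) ^ n * fibSum (-a / b ^ 2) n * this

theorem trinomial_sum_pow_card_sub_one {F K : Type*} [Field F] [Field K] [Algebra F K] [Fintype F]
    [Fintype K] (hK : Fintype.card K = Fintype.card F ^ 2) (a b : F) :
    ∑ x : K, (algebraMap F K a * x + algebraMap F K b * x ^ Fintype.card F +
        x ^ (2 * Fintype.card F - 1)) ^ (Fintype.card F - 1) =
      -algebraMap F K (((1 + C b * X + C a * X ^ 2 : F[X]) ^ (Fintype.card F - 1)).coeff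
        (Fintype.card F - 2)) := by
  set h : F[X] := 1 + C b * X + C a * X ^ 2 with hh
  have hq : 1 < Fintype.card F := Fintype.one_lt_card
  obtain ⟨r, hr⟩ : ∃ r, Fintype.card F = r + 2 := ⟨_, (Nat.sub_add_cancel hq).symm⟩
  generalize Fintype.card F = q at *
  subst hr
  have hdeg : (h ^ (r + 2 - 1)).natDegree < 2 * r + 3 := by
    have h1 : h.natDegree ≤ 2 := by rw [hh]; compute_degree
    have := natDegree_pow_le_of_le (r + 2 - 1) h1
    omega
  have hfac : ∀ x : K, algebraMap F K a * x + algebraMap F K b * x ^ (r + 2) +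
      x ^ (2 * (r + 2) - 1) = x ^ (2 * r + 3) * aeval (x ^ ((r + 2) * (r + 1))) h := by
    intro x
    have hx : x ^ ((r + 2) ^ 2) = x := by rw [← hK]; exact FiniteField.pow_card x
    have e1 : x ^ (2 * r + 3) * x ^ ((r + 2) * (r + 1)) = x ^ (r + 2) := by
      calc _ = x ^ ((r + 2) ^ 2) * x ^ (r + 1) := by ring
        _ = _ := by rw [hx]; ring
    have e2 : x ^ (2 * r + 3) * (x ^ ((r + 2) * (r + 1))) ^ 2 = x := by
      calc _ = x ^ (2 * r + 3) * x ^ ((r + 2) * (r + 1)) * x ^ ((r + 2) * (r + 1)) := by ring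
        _ = x ^ ((r + 2) ^ 2) := by rw [e1]; ring
        _ = x := hx
    rw [show 2 * (r + 2) - 1 = 2 * r + 3 by omega]
    simp only [hh, map_add, map_mul, map_pow, map_one, aeval_C, aeval_X]
    linear_combination -algebraMap F K b * e1 - algebraMap F K a * e2
  have hpow : ∀ x : K, (algebraMap F K a * x + algebraMap F K b * x ^ (r + 2) +
      x ^ (2 * (r + 2) - 1)) ^ (r + 2 - 1) = ∑ k ∈ range (2 * r + 3),
        algebraMap F K ((h ^ (r + 2 - 1)).coeff k) *
          x ^ ((r + 1) * (2 * r + 3 + (r + 2) * k)) := by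
    intro x
    rw [hfac, mul_pow, ← map_pow, aeval_eq_sum_range' hdeg, mul_sum]
    refine sum_congr rfl fun k _ => ?_
    rw [Algebra.smul_def, show r + 2 - 1 = r + 1 by omega]
    ring
  rw [sum_congr rfl fun x _ => hpow x, sum_comm]
  simp only [← mul_sum]
  have hsum : ∀ k ∈ range (2 * r + 3), ∑ x : K, x ^ ((r + 1) * (2 * r + 3 + (r + 2) * k)) =
      if k = r then -1 else 0 := by
    intro k hk
    have hk := mem_range.1 hk
    rw [FiniteField.sum_pow_of_ne_zero (by positivity), hK]
    refine if_congr ?_ rfl rfl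
    rw [show (r + 2) ^ 2 - 1 = (r + 1) * (r + 3) by
        rw [Nat.sub_eq_iff_eq_add (Nat.one_le_pow _ _ (by positivity))]; ring,
      Nat.mul_dvd_mul_iff_left (by positivity)]
    have : 2 * r + 3 + (r + 2) * k + (k + 3) = (r + 3) * (k + 2) := by ring
    constructor
    · intro hd
      obtain ⟨c, hc⟩ := (Nat.dvd_add_right hd).1 (this ▸ dvd_mul_right _ _)
      have h0 : 0 < c := Nat.pos_of_ne_zero (by rintro rfl; omega)
      have h2 : c < 2 := by by_contra! h2; nlinarith
      obtain rfl : c = 1 := by omega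
      omega
    · rintro rfl
      exact ⟨k + 1, by ring⟩
  rw [sum_congr rfl fun k hk => by rw [hsum k hk]]
  simp [show r < 2 * r + 3 by omega]

/-- For `f(x) = a·x + b·x^q + x^(2q−1)` with `a, b ∈ F_q^*`,
`∑_{x ∈ F_{q²}} f(x)^{(q−1)q} = (b/a)·(∑_{0 ≤ l ≤ ⌊q/2⌋} binom(−l, l)·(−a/b²)^l − 1)`,
where `binom(m, k)` is the generalized binomial coefficient (`Ring.choose` over `ℤ`),
interpreted in `F_q` via the canonical map `ℤ → F_q`. -/
theorem trinomial_power_sum_q_sub_one_q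
    (q : ℕ)
    (F K : Type*) [Field F] [Field K] [Algebra F K]
    [Fintype F] [Fintype K]
    (hF : Fintype.card F = q) (hK : Fintype.card K = q ^ 2)
    (a b : F) (ha : a ≠ 0) (hb : b ≠ 0) :
    ∑ x : K,
      (algebraMap F K a * x + algebraMap F K b * x ^ q + x ^ (2 * q - 1)) ^ ((q - 1) * q)
      = algebraMap F K
          ((b / a) *
            ((∑ l ∈ Finset.range (q / 2 + 1),
              ((Ring.choose (-(l : ℤ)) l : ℤ) : F) * (-a / b ^ 2) ^ l) - 1)) := by
  subst hF
  have hq : 1 < Fintype.card F := Fintype.one_lt_card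
  have hfrob : ∀ f : K → K, ∑ x, f x ^ Fintype.card F = (∑ x, f x) ^ Fintype.card F := by
    intro f
    exact (map_sum (FiniteField.frobeniusAlgHom F K) f univ).symm
  simp only [pow_mul]
  rw [hfrob, trinomial_sum_pow_card_sub_one hK, ← map_neg, ← map_pow, FiniteField.pow_card,
    coeff_trinomial_pow_card_sub_one hb (by omega), ← fibSum_card]
  congr 1
  have h1 := fibSum_card_sub_one (-a / b ^ 2)
  have h2 := fibSum_add_two (-a / b ^ 2) (Fintype.card F - 2)
  have h3 := FiniteField.pow_card_sub_one_eq_one (-b) (neg_ne_zero.2 hb)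
  rw [show Fintype.card F - 2 + 2 = Fintype.card F by omega,
    show Fintype.card F - 2 + 1 = Fintype.card F - 1 by omega, h1] at h2
  rw [show Fintype.card F - 1 = Fintype.card F - 2 + 1 by omega, pow_succ] at h3
  generalize fibSum (-a / b ^ 2) (Fintype.card F) = T at *
  generalize fibSum (-a / b ^ 2) (Fintype.card F - 2) = B at *
  generalize (-b) ^ (Fintype.card F - 2) = c at *
  have hT : T - 1 = a / b ^ 2 * B := by linear_combination -h2
  rw [hT]
  field_simp
  linear_combination B * h3
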